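/- Assume (H) with L_g = g'(0) and g strictly increasing. Let φ be a wavefront with speed c, let q* > 0, q_* ∈ (0,κ), δ* ∈ (0,δ₀), γ* > 0 satisfy (gg1) and (gg), fix γ ∈ [0,γ*) and λ > 0 with −γ + cλ − λ² + 1 − g'(0)e^{γh}e^{−λch} ≥ 0, and let b > 0 satisfy φ(b−ch) = κ − δ*/2. Suppose sup_{s∈[−h,0]} |φ(·) − w₀(s,·)|_λ < ρ e^{−λb} for some ρ with 0 < ρ ≤ min{q*, q_*} (in particular ρ < κ). Then every classical solution w of (E1) with initial datum w₀ satisfies |φ(·) − w(t,·)|_λ < ρ e^{−γt} for all t ≥ 0. -/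

import Mathlib

open Set Filter

noncomputable section

/-- The weight function `η_λ(t) = min{e^{λt}, 1}`. -/
def eta (lam t : ℝ) : ℝ := min (Real.exp (lam * t)) 1

/-- The characteristic function `χ₀(λ) = λ² − cλ − 1 + g0·e^{−λch}` (with `g0 = g'(0)`). -/
def chi (g0 c h lam : ℝ) : ℝ := lam ^ 2 - c * lam - 1 + g0 * Real.exp (-(lam * c * h))

/-- Hypothesis (H) on the birth function `g` (extended linearly and C¹-smoothly to `(−∞,0]`). -/
structure HypH (g : ℝ → ℝ) (kap del0 Lg : ℝ) : Prop where
  cont : Continuous g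
  nonneg : ∀ x : ℝ, 0 ≤ x → 0 ≤ g x
  kap_pos : 0 < kap
  del0_pos : 0 < del0
  fixed_points : ∀ x : ℝ, 0 ≤ x → (g x = x ↔ x = 0 ∨ x = kap)
  smooth0 : ContDiffOn ℝ 1 g (Set.Ioo (-del0) del0)
  smooth_kap : ContDiffOn ℝ 1 g (Set.Ioo (kap - del0) (kap + del0))
  deriv0_gt : 1 < deriv g 0
  deriv_kap_lt : deriv g kap < 1
  lipschitz : ∀ u v : ℝ, 0 ≤ u → 0 ≤ v → |g u - g v| ≤ Lg * |u - v|
  holder : ∃ C > (0:ℝ), ∃ θ ∈ Set.Ioc (0:ℝ) 1,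
      ∀ u ∈ Set.Ioc (0:ℝ) del0, |deriv g u - deriv g 0| ≤ C * u ^ θ
  ext_linear : ∀ x : ℝ, x ≤ 0 → g x = deriv g 0 * x

/-- (IC1): `0 ≤ w₀ ≤ sup w₀ < ∞` on `Π₀ = [−h,0]×ℝ`. -/
def IC1 (h : ℝ) (w0 : ℝ → ℝ → ℝ) : Prop :=
  ∃ M : ℝ, ∀ s ∈ Set.Icc (-h) 0, ∀ x : ℝ, 0 ≤ w0 s x ∧ w0 s x ≤ M

/-- (IC2): `liminf_{x→+∞} min_{s∈[−h,0]} w₀(s,x) > 0`. -/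
def IC2 (h : ℝ) (w0 : ℝ → ℝ → ℝ) : Prop :=
  ∃ m > (0:ℝ), ∃ X : ℝ, ∀ x ≥ X, ∀ s ∈ Set.Icc (-h) 0, m ≤ w0 s x

/-- `w₀` is locally Hölder continuous in `x`, uniformly in `s ∈ [−h,0]`. -/
def LocHolder (h : ℝ) (w0 : ℝ → ℝ → ℝ) : Prop :=
  ∀ R > (0:ℝ), ∃ K > (0:ℝ), ∃ β ∈ Set.Ioc (0:ℝ) 1,
    ∀ s ∈ Set.Icc (-h) 0, ∀ x ∈ Set.Icc (-R) R, ∀ y ∈ Set.Icc (-R) R,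
      |w0 s x - w0 s y| ≤ K * |x - y| ^ β

/-- A classical solution of the equation (*):
`u_t(t,x) = u_{xx}(t,x) − u(t,x) + g(u(t−h,x))` for `t > 0`, `x ∈ ℝ`. -/
def SolvesStar (g : ℝ → ℝ) (h : ℝ) (u : ℝ → ℝ → ℝ) : Prop :=
  ContinuousOn (fun p : ℝ × ℝ => u p.1 p.2) {p : ℝ × ℝ | -h ≤ p.1} ∧
  (∀ T : ℝ, ∃ M : ℝ, ∀ t ∈ Set.Icc (-h) T, ∀ x : ℝ, |u t x| ≤ M) ∧
  (∀ t : ℝ, 0 < t → ∀ x : ℝ,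
      DifferentiableAt ℝ (fun τ => u τ x) t ∧
      DifferentiableAt ℝ (fun y => u t y) x ∧
      DifferentiableAt ℝ (deriv (fun y => u t y)) x ∧
      deriv (fun τ => u τ x) t =
        deriv (deriv (fun y => u t y)) x - u t x + g (u (t - h) x)) ∧
  ContinuousOn (fun p : ℝ × ℝ => deriv (fun τ => u τ p.2) p.1) {p : ℝ × ℝ | 0 < p.1} ∧
  ContinuousOn (fun p : ℝ × ℝ => deriv (fun y => u p.1 y) p.2) {p : ℝ × ℝ | 0 < p.1} ∧
  ContinuousOn (fun p : ℝ × ℝ => deriv (deriv (fun y => u p.1 y)) p.2) {p : ℝ × ℝ | 0 < p.1}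

/-- A classical solution of equation (E1):
`w_t = w_{zz} − c w_z − w + g(w(t−h, z−ch))` for `t > 0`, `z ∈ ℝ`. -/
def SolvesE1 (g : ℝ → ℝ) (h c : ℝ) (w : ℝ → ℝ → ℝ) : Prop :=
  ContinuousOn (fun p : ℝ × ℝ => w p.1 p.2) {p : ℝ × ℝ | -h ≤ p.1} ∧
  (∀ T : ℝ, ∃ M : ℝ, ∀ t ∈ Set.Icc (-h) T, ∀ z : ℝ, |w t z| ≤ M) ∧
  (∀ t : ℝ, 0 < t → ∀ z : ℝ,
      DifferentiableAt ℝ (fun τ => w τ z) t ∧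
      DifferentiableAt ℝ (fun y => w t y) z ∧
      DifferentiableAt ℝ (deriv (fun y => w t y)) z ∧
      deriv (fun τ => w τ z) t =
        deriv (deriv (fun y => w t y)) z - c * deriv (fun y => w t y) z
          - w t z + g (w (t - h) (z - c * h))) ∧
  ContinuousOn (fun p : ℝ × ℝ => deriv (fun τ => w τ p.2) p.1) {p : ℝ × ℝ | 0 < p.1} ∧
  ContinuousOn (fun p : ℝ × ℝ => deriv (fun y => w p.1 y) p.2) {p : ℝ × ℝ | 0 < p.1} ∧
  ContinuousOn (fun p : ℝ × ℝ => deriv (deriv (fun y => w p.1 y)) p.2) {p : ℝ × ℝ | 0 < p.1}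

/-- A wavefront with speed `c`: a positive bounded C² solution of the profile equation
with `φ(−∞) = 0`, `φ(+∞) = κ`. -/
def IsWavefront (g : ℝ → ℝ) (h c kap : ℝ) (φ : ℝ → ℝ) : Prop :=
  (∀ z : ℝ, 0 < φ z) ∧ (∃ M : ℝ, ∀ z : ℝ, φ z ≤ M) ∧ ContDiff ℝ 2 φ ∧
  (∀ z : ℝ, deriv (deriv φ) z - c * deriv φ z - φ z + g (φ (z - c * h)) = 0) ∧
  Filter.Tendsto φ Filter.atBot (nhds 0) ∧ Filter.Tendsto φ Filter.atTop (nhds kap)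

/-- A semi-wavefront with speed `c`: as a wavefront, but at `+∞` only
`liminf_{z→+∞} φ(z) > 0` is required. -/
def IsSemiWavefront (g : ℝ → ℝ) (h c : ℝ) (φ : ℝ → ℝ) : Prop :=
  (∀ z : ℝ, 0 < φ z) ∧ (∃ M : ℝ, ∀ z : ℝ, φ z ≤ M) ∧ ContDiff ℝ 2 φ ∧
  (∀ z : ℝ, deriv (deriv φ) z - c * deriv φ z - φ z + g (φ (z - c * h)) = 0) ∧
  Filter.Tendsto φ Filter.atBot (nhds 0) ∧
  (∃ m > (0:ℝ), ∀ᶠ z in Filter.atTop, m ≤ φ z)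

/-- The nonlinear operator `𝒩` associated with (E1). -/
def Nop (g : ℝ → ℝ) (h c : ℝ) (w : ℝ → ℝ → ℝ) (t z : ℝ) : ℝ :=
  deriv (fun τ => w τ z) t - deriv (deriv (fun y => w t y)) z
    + c * deriv (fun y => w t y) z + w t z - g (w (t - h) (z - c * h))

/-- A super-solution of (E1) with break point `zs`. -/
def IsSuperSolution (g : ℝ → ℝ) (h c : ℝ) (w : ℝ → ℝ → ℝ) (zs : ℝ) : Prop :=
  ContinuousOn (fun p : ℝ × ℝ => w p.1 p.2) {p : ℝ × ℝ | -h ≤ p.1} ∧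
  (∀ t : ℝ, -h < t → ∀ z : ℝ, DifferentiableAt ℝ (fun τ => w τ z) t) ∧
  (∀ t : ℝ, -h ≤ t → ∀ z : ℝ, z ≠ zs →
      DifferentiableAt ℝ (fun y => w t y) z ∧
      DifferentiableAt ℝ (deriv (fun y => w t y)) z) ∧
  (∀ t : ℝ, 0 < t → ∀ z : ℝ, z ≠ zs → 0 ≤ Nop g h c w t z) ∧
  (∀ t : ℝ, 0 < t →
      derivWithin (fun y => w t y) (Set.Iic zs) zs
        > derivWithin (fun y => w t y) (Set.Ici zs) zs)

/-- A sub-solution of (E1) with break point `zs` (all inequalities reversed). -/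
def IsSubSolution (g : ℝ → ℝ) (h c : ℝ) (w : ℝ → ℝ → ℝ) (zs : ℝ) : Prop :=
  ContinuousOn (fun p : ℝ × ℝ => w p.1 p.2) {p : ℝ × ℝ | -h ≤ p.1} ∧
  (∀ t : ℝ, -h < t → ∀ z : ℝ, DifferentiableAt ℝ (fun τ => w τ z) t) ∧
  (∀ t : ℝ, -h ≤ t → ∀ z : ℝ, z ≠ zs →
      DifferentiableAt ℝ (fun y => w t y) z ∧
      DifferentiableAt ℝ (deriv (fun y => w t y)) z) ∧
  (∀ t : ℝ, 0 < t → ∀ z : ℝ, z ≠ zs → Nop g h c w t z ≤ 0) ∧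
  (∀ t : ℝ, 0 < t →
      derivWithin (fun y => w t y) (Set.Iic zs) zs
        < derivWithin (fun y => w t y) (Set.Ici zs) zs)

/-- Inequality (gg1). -/
def GG1 (g : ℝ → ℝ) (kap h dstar qlow gstar : ℝ) : Prop :=
  ∀ u ∈ Set.Icc (kap - dstar) kap, ∀ q ∈ Set.Icc (0:ℝ) qlow,
    ∀ γ ∈ Set.Icc (0:ℝ) gstar,
      g u - g (u - q * Real.exp (γ * h)) ≤ q * (1 - 2 * γ)

/-- Inequality (gg). -/
def GG2 (g : ℝ → ℝ) (kap h dstar qstar gstar : ℝ) : Prop :=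
  ∀ u ∈ Set.Icc (kap - dstar) kap, ∀ q ∈ Set.Icc (0:ℝ) qstar,
    ∀ γ ∈ Set.Icc (0:ℝ) gstar,
      -(q * (1 - 2 * γ)) ≤ g u - g (u + q * Real.exp (γ * h))

/-- A function on the line has nonpositive second derivative at a global maximum. -/
theorem second_deriv_nonpos_of_forall_le {f f' : ℝ → ℝ} {f'' x : ℝ}
    (hf : ∀ y, HasDerivAt f (f' y) y) (hf' : HasDerivAt f' f'' x) (hmax : ∀ y, f y ≤ f x) :
    f'' ≤ 0 := by
  by_contra! hpos
  have hd : deriv f = f' := funext fun y => (hf y).deriv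
  have hloc : IsLocalMax f x := Eventually.of_forall hmax
  have h0 : f' x = 0 := hloc.hasDerivAt_eq_zero (hf x)
  have hmin : IsLocalMin f x := by
    apply isLocalMin_of_deriv_deriv_pos
    · rwa [hd, hf'.deriv]
    · rwa [hd]
    · exact (hf x).continuousAt
  have hconst : f =ᶠ[nhds x] fun _ => f x := by
    filter_upwards [hmin] with y hy
    exact le_antisymm (hmax y) hy
  have h1 : f' =ᶠ[nhds x] fun _ => 0 := by
    have := hconst.deriv
    rw [hd] at this
    simpa using this
  have h2 := h1.deriv_eq
  rw [hf'.deriv] at h2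
  simp at h2
  linarith

/-- A function has nonnegative derivative at a point where it is maximal over an interval
ending there. -/
theorem deriv_nonneg_of_forall_le_left {f : ℝ → ℝ} {f' a t : ℝ} (hf : HasDerivAt f f' t)
    (hat : a < t) (hmax : ∀ y ∈ Ioc a t, f y ≤ f t) : 0 ≤ f' := by
  have h := (hasDerivWithinAt_iff_tendsto_slope' (s := Iio t) (by simp)).1 hf.hasDerivWithinAt
  refine ge_of_tendsto h ?_
  filter_upwards [Ioo_mem_nhdsLT hat] with y hy
  rw [slope_def_field]
  exact div_nonneg_of_nonpos (by linarith [hmax y ⟨hy.1, hy.2.le⟩]) (by linarith [hy.2])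

/-- Linear growth bound from an upper bound on the derivative. -/
theorem sub_le_of_hasDerivAt_le {f f' : ℝ → ℝ} {C y z : ℝ} (hyz : y ≤ z)
    (hf : ∀ x ∈ Icc y z, HasDerivAt f (f' x) x) (h : ∀ x ∈ Icc y z, f' x ≤ C) :
    f z - f y ≤ C * (z - y) := by
  refine (convex_Icc y z).image_sub_le_mul_sub_of_deriv_le
    (fun x hx => (hf x hx).continuousAt.continuousWithinAt)
    (fun x hx => (hf x (interior_subset hx)).differentiableAt.differentiableWithinAt)
    (fun x hx => ?_) y (left_mem_Icc.2 hyz) z (right_mem_Icc.2 hyz) hyz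
  rw [(hf x (interior_subset hx)).deriv]
  exact h x (interior_subset hx)

/-- Linear growth bound from a lower bound on the derivative. -/
theorem le_sub_of_le_hasDerivAt {f f' : ℝ → ℝ} {C y z : ℝ} (hyz : y ≤ z)
    (hf : ∀ x ∈ Icc y z, HasDerivAt f (f' x) x) (h : ∀ x ∈ Icc y z, C ≤ f' x) :
    C * (z - y) ≤ f z - f y := by
  have := sub_le_of_hasDerivAt_le (f := fun x => -f x) (f' := fun x => -f' x) (C := -C) hyz
    (fun x hx => (hf x hx).neg) (fun x hx => neg_le_neg (h x hx))
  linarith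

/-- Grönwall's inequality for a scalar differential inequality. -/
theorem le_exp_mul_of_hasDerivAt_le {f f' : ℝ → ℝ} {a y z : ℝ} (hyz : y ≤ z)
    (hf : ∀ x ∈ Icc y z, HasDerivAt f (f' x) x) (h : ∀ x ∈ Icc y z, f' x ≤ a * f x) :
    f z ≤ Real.exp (a * (z - y)) * f y := by
  have hd : ∀ x ∈ Icc y z, HasDerivAt (fun x => Real.exp (-(a * x)) * f x)
      (Real.exp (-(a * x)) * (f' x - a * f x)) x := by
    intro x hx
    have h1 : HasDerivAt (fun x => Real.exp (-(a * x))) (Real.exp (-(a * x)) * (-a)) x := by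
      have := ((hasDerivAt_id x).const_mul a).neg.exp
      simpa using this
    exact (h1.mul (hf x hx)).congr_deriv (by ring)
  have key := sub_le_of_hasDerivAt_le (C := 0) hyz hd (fun x hx =>
    mul_nonpos_of_nonneg_of_nonpos (Real.exp_pos _).le (by linarith [h x hx]))
  have e1 : Real.exp (a * z) * Real.exp (-(a * z)) = 1 := by rw [← Real.exp_add]; simp
  have e2 : Real.exp (a * (z - y)) = Real.exp (a * z) * Real.exp (-(a * y)) := by
    rw [← Real.exp_add]; ring_nf
  calc f z = Real.exp (a * z) * (Real.exp (-(a * z)) * f z) := by rw [← mul_assoc, e1, one_mul]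
    _ ≤ Real.exp (a * z) * (Real.exp (-(a * y)) * f y) := by
        apply mul_le_mul_of_nonneg_left _ (Real.exp_pos _).le; linarith
    _ = _ := by rw [e2]; ring

/-- A nonnegative function on a left half-line with `D'' - c D' - D ≤ 0` satisfies `D' ≤ μ D`,
where `μ` is the positive root of `μ² - cμ - 1`. -/
theorem deriv_le_mul_of_supersolution {D D' D'' : ℝ → ℝ} {c μ Z : ℝ} (hμ : 0 < μ)
    (hroot : μ ^ 2 - c * μ - 1 = 0) (hD : ∀ z, HasDerivAt D (D' z) z)
    (hD' : ∀ z, HasDerivAt D' (D'' z) z) (hpos : ∀ z ≤ Z, 0 ≤ D z)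
    (hsup : ∀ z ≤ Z, D'' z - c * D' z - D z ≤ 0) {z : ℝ} (hz : z ≤ Z) : D' z ≤ μ * D z := by
  by_contra! hlt
  set N := fun x => D' x - μ * D x with hN
  have hNz : 0 < N z := by simp only [hN]; linarith
  have hcμ : c - μ < 0 := by nlinarith
  have hND : ∀ x, HasDerivAt N (D'' x - μ * D' x) x := fun x =>
    (hD' x).sub ((hD x).const_mul μ)
  have hNge : ∀ x ≤ z, N z ≤ N x := by
    intro x hx
    have h1 : N z ≤ Real.exp ((c - μ) * (z - x)) * N x := by
      refine le_exp_mul_of_hasDerivAt_le hx (fun y _ => hND y) fun y hy => ?_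
      have h2 := hsup y (hy.2.trans hz)
      simp only [hN]
      linear_combination h2 - D y * hroot
    have h3 : Real.exp ((c - μ) * (z - x)) ≤ 1 := Real.exp_le_one_iff.2
      (mul_nonpos_of_nonpos_of_nonneg hcμ.le (by linarith))
    have h4 : 0 < N x := by
      by_contra! h5
      have := mul_nonpos_of_nonneg_of_nonpos (Real.exp_pos ((c - μ) * (z - x))).le h5
      linarith
    nlinarith
  have hDz := hpos z hz
  have hle : z - (D z + 1) / N z ≤ z := by
    have : 0 ≤ (D z + 1) / N z := by positivity
    linarith
  have h6 := le_sub_of_le_hasDerivAt (C := N z) hle (fun x _ => hD x) (fun x hx => by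
    have h7 := hNge x hx.2
    have h8 := hpos x (hx.2.trans hz)
    have h9 : N x = D' x - μ * D x := rfl
    nlinarith)
  have h10 : N z * (z - (z - (D z + 1) / N z)) = D z + 1 := by
    field_simp; ring
  have h11 := hpos _ (hle.trans hz)
  linarith

/-- A nonnegative function on the line with `D'' - c D' - D ≤ 0` satisfies `(c - μ) D ≤ D'`,
where `c - μ` is the negative root of `μ² - cμ - 1`. -/
theorem mul_le_deriv_of_supersolution {D D' D'' : ℝ → ℝ} {c μ : ℝ} (hμ : 0 < μ)
    (hroot : μ ^ 2 - c * μ - 1 = 0) (hD : ∀ z, HasDerivAt D (D' z) z)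
    (hD' : ∀ z, HasDerivAt D' (D'' z) z) (hpos : ∀ z, 0 ≤ D z)
    (hsup : ∀ z, D'' z - c * D' z - D z ≤ 0) (z : ℝ) : (c - μ) * D z ≤ D' z := by
  have hcμ : c - μ < 0 := by nlinarith
  have h := deriv_le_mul_of_supersolution (D := fun x => D (-x)) (D' := fun x => -D' (-x))
    (D'' := fun x => D'' (-x)) (c := -c) (μ := μ - c) (Z := -z) (z := -z) (by linarith)
    (by linear_combination hroot) (fun x => ?_) (fun x => ?_) (fun x _ => hpos _)
    (fun x _ => by have := hsup (-x); linarith) le_rfl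
  · simp only [neg_neg] at h
    linarith
  · exact ((hD (-x)).comp x (hasDerivAt_neg x)).congr_deriv (by ring)
  · exact ((hD' (-x)).comp x (hasDerivAt_neg x)).neg.congr_deriv (by ring)

/-- The quadratic `μ² - cμ - 1` has a positive root. -/
theorem exists_pos_root (c : ℝ) : ∃ μ : ℝ, 0 < μ ∧ μ ^ 2 - c * μ - 1 = 0 := by
  have hs := Real.sq_sqrt (show 0 ≤ c ^ 2 + 4 by positivity)
  have hlt : |c| < √(c ^ 2 + 4) := by
    rw [← Real.sqrt_sq_eq_abs]
    exact Real.sqrt_lt_sqrt (sq_nonneg c) (by linarith)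
  refine ⟨(c + √(c ^ 2 + 4)) / 2, ?_, by nlinarith⟩
  linarith [neg_abs_le c]

/-- Exponential growth at `-∞` of positive bounded profiles: where the reaction exceeds
`(1 + ε) φ`, a profile vanishing at `-∞` grows exponentially from left to right. -/
theorem exists_exponential_growth {φ φ' φ'' G : ℝ → ℝ} {c τ ε Z : ℝ} (hc : 0 < c) (hτ : 0 < τ)
    (hε : 0 < ε) (hφ : ∀ z, HasDerivAt φ (φ' z) z) (hφ' : ∀ z, HasDerivAt φ' (φ'' z) z)
    (hpos : ∀ z, 0 < φ z) (hG : ∀ z, 0 ≤ G z)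
    (heq : ∀ z, φ'' z - c * φ' z - φ z + G (z - τ) = 0)
    (hlim : Tendsto φ atBot (nhds 0)) (hgrow : ∀ z ≤ Z, (1 + ε) * φ z ≤ G z) :
    ∃ C > 0, ∃ θ > 0, ∀ s ≥ 0, ∀ z, z + s ≤ Z → C * Real.exp (θ * s) * φ z ≤ φ (z + s) := by
  obtain ⟨μ, hμ, hroot⟩ := exists_pos_root c
  have hcμ : c - μ < 0 := by nlinarith
  have hsup : ∀ z, φ'' z - c * φ' z - φ z ≤ 0 := fun z => by linarith [heq z, hG (z - τ)]
  have hup : ∀ z, φ' z ≤ μ * φ z := fun z =>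
    deriv_le_mul_of_supersolution hμ hroot hφ hφ' (fun z _ => (hpos z).le)
      (fun z _ => hsup z) le_rfl
  have hlow : ∀ z, (c - μ) * φ z ≤ φ' z :=
    mul_le_deriv_of_supersolution hμ hroot hφ hφ' (fun z => (hpos z).le) hsup
  have hcont : Continuous φ := continuous_iff_continuousAt.2 fun z => (hφ z).continuousAt
  set A : ℝ → ℝ := fun z => ∫ x in (0:ℝ)..z, φ x with hA
  have hAd : ∀ z, HasDerivAt A (φ z) z := fun z =>
    (hcont.integral_hasStrictDerivAt 0 z).hasDerivAt
  have hAmono : Monotone A := monotone_of_deriv_nonneg (fun z => (hAd z).differentiableAt)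
    fun z => by rw [(hAd z).deriv]; exact (hpos z).le
  have hAsub : ∀ z, HasDerivAt (fun x => A (x - τ)) (φ (z - τ)) z := fun z =>
    (hAd (z - τ)).comp_sub_const z τ
  -- `φ` on the left of `z` is controlled by `φ z`
  set C1 := τ * Real.exp ((μ - c) * τ) with hC1
  have hC1pos : 0 < C1 := by positivity
  have hleft : ∀ z, A z - A (z - τ) ≤ C1 * φ z := by
    intro z
    have := sub_le_of_hasDerivAt_le (C := Real.exp ((μ - c) * τ) * φ z)
      (show z - τ ≤ z by linarith) (fun x _ => hAd x) (fun x hx => by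
        have h1 := le_exp_mul_of_hasDerivAt_le (f := fun x => -φ x) (f' := fun x => -φ' x)
          (a := c - μ) hx.2 (fun y _ => (hφ y).neg) (fun y _ => by linarith [hlow y])
        have e1 : Real.exp ((c - μ) * (z - x)) * Real.exp ((μ - c) * (z - x)) = 1 := by
          rw [← Real.exp_add, ← Real.exp_zero]; congr 1; ring
        have h2 : φ x ≤ Real.exp ((μ - c) * (z - x)) * φ z := by
          have h3 := mul_le_mul_of_nonneg_left h1 (Real.exp_pos ((μ - c) * (z - x))).le
          linear_combination h3 - φ x * e1
        refine h2.trans (mul_le_mul_of_nonneg_right (Real.exp_le_exp.2 ?_) (hpos z).le)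
        apply mul_le_mul_of_nonneg_left _ (by linarith)
        linarith [hx.1])
    calc _ ≤ _ := this
      _ = _ := by rw [hC1]; ring
  have hright : ∀ z, Real.exp (-μ) * φ z ≤ A z - A (z - 1) := by
    intro z
    have := le_sub_of_le_hasDerivAt (C := Real.exp (-μ) * φ z)
      (show z - 1 ≤ z by linarith) (fun x _ => hAd x) (fun x hx => by
        have h1 := le_exp_mul_of_hasDerivAt_le (a := μ) hx.2 (fun y _ => hφ y) (fun y _ => hup y)
        have h2 : Real.exp (μ * (z - x)) ≤ Real.exp μ := Real.exp_le_exp.2 (by nlinarith [hx.1])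
        have h3 : φ z ≤ Real.exp μ * φ x :=
          h1.trans (mul_le_mul_of_nonneg_right h2 (hpos x).le)
        have e1 : Real.exp (-μ) * Real.exp μ = 1 := by rw [← Real.exp_add]; simp
        have h4 := mul_le_mul_of_nonneg_left h3 (Real.exp_pos (-μ)).le
        linear_combination h4 + φ x * e1)
    linarith
  set C3 := c + (μ - c) + C1 + ε * C1 with hC3
  have hC3pos : 0 < C3 := by rw [hC3]; nlinarith [mul_pos hε hC1pos]
  have hinter : ∀ z ≤ Z, ∀ y ≤ z, ε * (A z - A (y - τ)) ≤ μ * φ y + C3 * φ z := by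
    intro z hz y hy
    have hF := sub_le_of_hasDerivAt_le (C := 0)
      (f := fun x => φ' x - c * φ x - A x + A (x - τ) + ε * A (x - τ)) hy
      (fun x _ => (((((hφ' x).sub ((hφ x).const_mul c)).sub (hAd x)).add (hAsub x)).add
        ((hAsub x).const_mul ε))) (fun x hx => by
          have := hgrow (x - τ) (by linarith [hx.2])
          linarith [heq x])
    simp only [zero_mul] at hF
    have h1 := hup y
    have h2 := hlow z
    have h3 := hleft z
    have h4 : A (y - τ) ≤ A y := hAmono (by linarith)
    have h5 := mul_pos hc (hpos y)
    have h6 := mul_le_mul_of_nonneg_left h3 hε.le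
    rw [hC3]
    linarith
  obtain ⟨B, hB⟩ : ∃ B, ∀ y, B ≤ A y := by
    have hev : ∀ᶠ y in atBot, φ y ≤ 1 := (hlim.eventually_lt_const one_pos).mono fun _ h => h.le
    obtain ⟨Y, hY⟩ := eventually_atBot.1 hev
    refine ⟨A Z - (μ + C3 * φ Z) / ε, fun y => ?_⟩
    set y' := min (y + τ) (min Y Z) with hy'
    have h1 := hinter Z le_rfl y' ((min_le_right _ _).trans (min_le_right _ _))
    have h2 := hY y' ((min_le_right _ _).trans (min_le_left _ _))
    have h3 : A (y' - τ) ≤ A y := hAmono (by linarith [min_le_left (y + τ) (min Y Z)])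
    have h4 : A Z - A (y' - τ) ≤ (μ + C3 * φ Z) / ε := by
      rw [le_div_iff₀ hε]; nlinarith
    linarith
  have hAlim := tendsto_atBot_ciInf hAmono ⟨B, by rintro _ ⟨y, rfl⟩; exact hB y⟩
  set l := ⨅ y, A y with hl
  have hlA : ∀ y, l ≤ A y := fun y => ciInf_le ⟨B, by rintro _ ⟨y, rfl⟩; exact hB y⟩ y
  have hΨ : ∀ z ≤ Z, ε * (A z - l) ≤ C3 * φ z := by
    intro z hz
    have t1 : Tendsto (fun y => ε * (A z - A (y - τ))) atBot (nhds (ε * (A z - l))) :=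
      (tendsto_const_nhds.sub
        (hAlim.comp (tendsto_atBot_add_const_right _ (-τ) tendsto_id))).const_mul ε
    have t2 : Tendsto (fun y => μ * φ y + C3 * φ z) atBot (nhds (μ * 0 + C3 * φ z)) :=
      (hlim.const_mul μ).add_const _
    have := le_of_tendsto_of_tendsto t1 t2
      ((eventually_le_atBot z).mono fun y hy => hinter z hz y hy)
    simpa using this
  refine ⟨ε / C3 * Real.exp (-μ), by positivity, ε / C3, by positivity, fun s hs z hz => ?_⟩
  have hθ : ∀ z ≤ Z, ε / C3 * (A z - l) ≤ φ z := fun z hz => by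
    rw [div_mul_eq_mul_div, div_le_iff₀ hC3pos]; linarith [hΨ z hz]
  have h1 := le_exp_mul_of_hasDerivAt_le (f := fun x => -(A x - l)) (f' := fun x => -φ x)
    (a := ε / C3) (show z ≤ z + s by linarith) (fun x _ => ((hAd x).sub_const l).neg)
    (fun x hx => by have := hθ x (hx.2.trans hz); linarith)
  have h2 := hθ (z + s) hz
  have h3 : Real.exp (-μ) * φ z ≤ A z - l := by linarith [hright z, hlA (z - 1)]
  have e : z + s - z = s := by ring
  rw [e] at h1
  have h4 : Real.exp (ε / C3 * s) * (Real.exp (-μ) * φ z) ≤ A (z + s) - l := by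
    have := mul_le_mul_of_nonneg_left h3 (Real.exp_pos (ε / C3 * s)).le
    linarith
  have h5 := mul_le_mul_of_nonneg_left h4 (show 0 ≤ ε / C3 by positivity)
  linarith

/-- A profile vanishing at `-∞` is eventually ordered with each of its right translates. -/
theorem eventually_le_translate {φ φ' φ'' g : ℝ → ℝ} {c τ p s : ℝ} (hc : 0 < c) (hτ : 0 < τ)
    (hp : 1 < p) (hs : 0 < s) (hg0 : g 0 = 0) (hgd : HasDerivAt g p 0)
    (hgnn : ∀ u, 0 ≤ u → 0 ≤ g u) (hgle : ∀ u, 0 ≤ u → g u ≤ p * u)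
    (hφ : ∀ z, HasDerivAt φ (φ' z) z) (hφ' : ∀ z, HasDerivAt φ' (φ'' z) z)
    (hpos : ∀ z, 0 < φ z) (heq : ∀ z, φ'' z - c * φ' z - φ z + g (φ (z - τ)) = 0)
    (hlim : Tendsto φ atBot (nhds 0)) : ∀ᶠ z in atBot, φ z ≤ φ (z + s) := by
  obtain ⟨μ, hμ, hroot⟩ := exists_pos_root c
  have hlin : ∀ q < p, ∀ᶠ z in atBot, q * φ z ≤ g (φ z) := by
    intro q hq
    have h1 := hgd.isLittleO.bound (sub_pos.2 hq)
    filter_upwards [hlim.eventually h1] with z hz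
    simp only [hg0, sub_zero, smul_eq_mul, Real.norm_eq_abs, abs_of_pos (hpos z)] at hz
    linarith [neg_abs_le (g (φ z) - φ z * p)]
  obtain ⟨Z0, hZ0⟩ := eventually_atBot.1 (hlin (1 + (p - 1) / 2) (by linarith))
  obtain ⟨C, hC, θ, hθ, hgrowth⟩ := exists_exponential_growth (G := fun z => g (φ z)) hc hτ
    (show 0 < (p - 1) / 2 by linarith) hφ hφ' hpos (fun z => hgnn _ (hpos z).le) heq hlim hZ0
  obtain ⟨J, hJ⟩ : ∃ J : ℕ, 2 ≤ C * Real.exp (θ * (J * s)) := by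
    obtain ⟨J, hJ⟩ := exists_nat_ge (2 / (C * (θ * s)))
    refine ⟨J, ?_⟩
    rw [div_le_iff₀ (by positivity)] at hJ
    have := Real.add_one_le_exp (θ * (J * s))
    nlinarith
  by_contra hnot
  set S : Set ℝ := {k | ∀ᶠ z in atBot, k * φ z ≤ φ (z + s)} with hS
  have hS0 : (0 : ℝ) ∈ S := Eventually.of_forall fun z => by simpa using (hpos _).le
  have hS1 : ∀ k ∈ S, k ≤ 1 := by
    intro k hk
    by_contra! hk1
    refine hnot (hk.mono fun z hz => ?_)
    nlinarith [hpos z]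
  have hbdd : BddAbove S := ⟨1, hS1⟩
  set K := Real.exp (μ * (J * s)) with hK
  have hKpos : 0 < K := Real.exp_pos _
  set ε := 1 / (3 * (J * K + 1)) with hε
  have hJK : (0 : ℝ) ≤ J * K := by positivity
  have hεpos : 0 < ε := by positivity
  have hεJK : 3 * ε * (J * K) < 1 := by
    have : 3 * ε * (J * K + 1) = 1 := by rw [hε]; field_simp
    linarith
  have hε1 : ε < 1 := by
    rw [hε, div_lt_one (by positivity)]; linarith
  obtain ⟨k, hkS, hk0, hkε⟩ : ∃ k ∈ S, 0 ≤ k ∧ sSup S - ε < k := by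
    obtain ⟨k, hk, hlt⟩ := exists_lt_of_lt_csSup ⟨0, hS0⟩ (show sSup S - ε < sSup S by linarith)
    rcases le_total 0 k with h | h
    · exact ⟨k, hk, h, hlt⟩
    · exact ⟨0, hS0, le_rfl, hlt.trans_le h⟩
  have hk1 := hS1 k hkS
  have hfreq : ∃ᶠ z in atBot, φ (z + s) < (sSup S + ε) * φ z := by
    have : sSup S + ε ∉ S := fun h => by linarith [le_csSup hbdd h]
    simpa [hS, Filter.Frequently, not_lt] using this
  have hlin' := (tendsto_atBot_add_const_right atBot s tendsto_id).eventually
    (hlin (p * (1 - ε)) (by nlinarith))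
  obtain ⟨Z1, hZ1⟩ := eventually_atBot.1 (hkS.and hlin')
  obtain ⟨z, hzZ, hz⟩ := frequently_atBot.1 hfreq (min (Z1 - J * s) (Z0 - J * s))
  have hzZ1 : z + J * s ≤ Z1 := by linarith [hzZ.trans (min_le_left _ _)]
  have hzZ0 : z + J * s ≤ Z0 := by linarith [hzZ.trans (min_le_right _ _)]
  set k' := k * (1 - ε) with hk'
  have hk'k : k' ≤ k := by rw [hk']; nlinarith
  have hD : ∀ x, HasDerivAt (fun x => φ (x + s) - k' * φ x) (φ' (x + s) - k' * φ' x) x :=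
    fun x => ((hφ (x + s)).comp_add_const x s).sub ((hφ x).const_mul k')
  have hD' : ∀ x, HasDerivAt (fun x => φ' (x + s) - k' * φ' x) (φ'' (x + s) - k' * φ'' x) x :=
    fun x => ((hφ' (x + s)).comp_add_const x s).sub ((hφ' x).const_mul k')
  have hDnn : ∀ x ≤ Z1, 0 ≤ φ (x + s) - k' * φ x := fun x hx => by
    nlinarith [(hZ1 x hx).1, hpos x]
  have hDle : ∀ x ≤ Z1, φ' (x + s) - k' * φ' x ≤ μ * (φ (x + s) - k' * φ x) := by
    intro x hx
    refine deriv_le_mul_of_supersolution hμ hroot hD hD' hDnn (fun y hy => ?_) hx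
    obtain ⟨h1, h2⟩ := hZ1 (y - τ) (by linarith)
    simp only [id] at h2
    have h3 := heq (y + s)
    have h4 := heq y
    have h5 := hgle _ (hpos (y - τ)).le
    have e : y + s - τ = y - τ + s := by ring
    rw [e] at h3
    have h6 : k' * g (φ (y - τ)) ≤ g (φ (y - τ + s)) := by
      have hk'0 : 0 ≤ k' := mul_nonneg hk0 (by linarith)
      calc k' * g (φ (y - τ)) ≤ k' * (p * φ (y - τ)) := mul_le_mul_of_nonneg_left h5 hk'0
        _ = p * (1 - ε) * (k * φ (y - τ)) := by rw [hk']; ring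
        _ ≤ p * (1 - ε) * φ (y - τ + s) :=
          mul_le_mul_of_nonneg_left h1 (mul_nonneg (by linarith) (by linarith))
        _ ≤ _ := h2
    linear_combination h6 + h3 - k' * h4
  have hDz : φ (z + s) - k' * φ z ≤ 3 * ε * φ z := by
    have : sSup S + ε - k' ≤ 3 * ε := by rw [hk']; nlinarith
    nlinarith [hpos z]
  have hstep : ∀ i : ℕ, i ≤ J → φ (z + i * s) ≤ (1 + i * (3 * ε * K)) * φ z := by
    intro i
    induction i with
    | zero => intro _; simp
    | succ i ih =>
      intro hi
      have hiJ : (i : ℝ) ≤ J := by exact_mod_cast (Nat.le_succ i).trans hi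
      have his : (i : ℝ) * s ≤ J * s := mul_le_mul_of_nonneg_right hiJ hs.le
      have hi0 : 0 ≤ (i : ℝ) * s := by positivity
      have h1 := le_exp_mul_of_hasDerivAt_le (show z ≤ z + i * s by linarith)
        (fun x _ => hD x) (fun x hx => hDle x (by linarith [hx.2]))
      have e1 : μ * (z + i * s - z) = μ * (i * s) := by ring
      have e2 : z + i * s + s = z + (i + 1 : ℕ) * s := by push_cast; ring
      rw [e1, e2] at h1
      have h2 : Real.exp (μ * (i * s)) ≤ K :=
        Real.exp_le_exp.2 (mul_le_mul_of_nonneg_left his hμ.le)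
      have h3 : Real.exp (μ * (i * s)) * (φ (z + s) - k' * φ z) ≤ K * (3 * ε * φ z) :=
        mul_le_mul h2 hDz (hDnn z (by linarith)) hKpos.le
      have h4 := ih ((Nat.le_succ i).trans hi)
      have h5 : k' * φ (z + i * s) ≤ φ (z + i * s) := by
        have := hpos (z + i * s)
        nlinarith
      push_cast at h1 ⊢
      linarith
  have hlast := hstep J le_rfl
  have hg2 := hgrowth (J * s) (by positivity) z hzZ0
  have := hpos z
  have h7 := mul_le_mul_of_nonneg_right hJ this.le
  have h8 := mul_lt_mul_of_pos_right hεJK this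
  linarith

/-- Profiles for a monotone reaction term with `g(v) - g(u) ≤ p (v - u)`, vanishing at `-∞` and
convergent at `+∞`, are nondecreasing as soon as the linearisation at zero admits a positive
exponent `lam` with `p e^{-lam τ} ≤ 1 + c lam - lam²`. -/
theorem monotone_profile {φ φ' φ'' g : ℝ → ℝ} {c τ p lam kap : ℝ} (hc : 0 < c) (hτ : 0 < τ)
    (hp : 1 < p) (hlam : 0 < lam) (hg0 : g 0 = 0) (hgd : HasDerivAt g p 0)
    (hgmono : Monotone g) (hgLip : ∀ u v, u ≤ v → g v - g u ≤ p * (v - u))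
    (hchar : p * Real.exp (-(lam * τ)) ≤ 1 + c * lam - lam ^ 2)
    (hφ : ∀ z, HasDerivAt φ (φ' z) z) (hφ' : ∀ z, HasDerivAt φ' (φ'' z) z)
    (hpos : ∀ z, 0 < φ z) (heq : ∀ z, φ'' z - c * φ' z - φ z + g (φ (z - τ)) = 0)
    (hbot : Tendsto φ atBot (nhds 0)) (htop : Tendsto φ atTop (nhds kap)) : Monotone φ := by
  suffices H : ∀ s > 0, ∀ z, φ z ≤ φ (z + s) by
    intro x y hxy
    rcases hxy.eq_or_lt with rfl | h
    · rfl
    · simpa using H (y - x) (sub_pos.2 h) x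
  intro s hs
  by_contra! hcon
  obtain ⟨z0, hz0⟩ := hcon
  obtain ⟨Z, hZ⟩ := eventually_atBot.1 (eventually_le_translate hc hτ hp hs hg0 hgd
    (fun u hu => hg0 ▸ hgmono hu)
    (fun u hu => by simpa [hg0] using hgLip 0 u hu) hφ hφ' hpos heq hbot)
  set v : ℝ → ℝ := fun z => Real.exp (-(lam * z)) * (φ z - φ (z + s)) with hv
  have hexp : ∀ z, HasDerivAt (fun z => Real.exp (-(lam * z)))
      (Real.exp (-(lam * z)) * (-lam)) z := fun z => by
    simpa using ((hasDerivAt_id z).const_mul lam).neg.exp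
  have hu : ∀ z, HasDerivAt (fun z => φ z - φ (z + s)) (φ' z - φ' (z + s)) z := fun z =>
    (hφ z).sub ((hφ (z + s)).comp_add_const z s)
  have hu' : ∀ z, HasDerivAt (fun z => φ' z - φ' (z + s)) (φ'' z - φ'' (z + s)) z := fun z =>
    (hφ' z).sub ((hφ' (z + s)).comp_add_const z s)
  have hvd := fun z => (hexp z).mul (hu z)
  have hv0 : 0 < v z0 := mul_pos (Real.exp_pos _) (by linarith)
  have hvZ : ∀ z ≤ Z, v z ≤ 0 := fun z hz =>
    mul_nonpos_of_nonneg_of_nonpos (Real.exp_pos _).le (by linarith [hZ z hz])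
  have hvtop : Tendsto v atTop (nhds 0) := by
    have h1 : Tendsto (fun z => φ z - φ (z + s)) atTop (nhds (kap - kap)) :=
      htop.sub (htop.comp (tendsto_atTop_add_const_right _ s tendsto_id))
    have h2 : Tendsto (fun z => Real.exp (-(lam * z))) atTop (nhds 0) :=
      Real.tendsto_exp_neg_atTop_nhds_zero.comp (tendsto_id.const_mul_atTop hlam)
    simpa using h2.mul h1
  have hvcont : Continuous v := continuous_iff_continuousAt.2 fun z => (hvd z).continuousAt
  obtain ⟨z1, hz1⟩ := hvcont.exists_forall_ge' z0 (by
    rw [cocompact_eq_atBot_atTop, eventually_sup]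
    exact ⟨(eventually_le_atBot Z).mono fun z hz => (hvZ z hz).trans hv0.le,
      (hvtop.eventually_lt_const hv0).mono fun z hz => hz.le⟩)
  have hback : ∀ x, (∀ y, v y ≤ v x) → ∀ y, v y ≤ v (x - τ) := by
    intro x hx
    have hvx : 0 < v x := hv0.trans_le (hx z0)
    have hd1 : Real.exp (-(lam * x)) * (-lam) * (φ x - φ (x + s))
        + Real.exp (-(lam * x)) * (φ' x - φ' (x + s)) = 0 :=
      (show IsLocalMax v x from Eventually.of_forall hx).hasDerivAt_eq_zero (hvd x)
    have hd2 := second_deriv_nonpos_of_forall_le hvd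
      ((((hexp x).mul_const (-lam)).mul (hu x)).add ((hexp x).mul (hu' x))) hx
    have hE := Real.exp_pos (-(lam * x))
    have hd1' : φ' x - φ' (x + s) = lam * (φ x - φ (x + s)) := by
      have : Real.exp (-(lam * x)) * (φ' x - φ' (x + s) - lam * (φ x - φ (x + s))) = 0 := by
        linear_combination hd1
      rcases mul_eq_zero.1 this with h | h
      · exact absurd h hE.ne'
      · linarith
    have hd2' : φ'' x - φ'' (x + s) ≤ lam ^ 2 * (φ x - φ (x + s)) := by
      have : Real.exp (-(lam * x)) *
          (φ'' x - φ'' (x + s) - lam ^ 2 * (φ x - φ (x + s))) ≤ 0 := by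
        linear_combination hd2 + 2 * lam * Real.exp (-(lam * x)) * hd1'
      have := nonpos_of_mul_nonpos_right this hE
      linarith
    have hux : 0 < φ x - φ (x + s) := pos_of_mul_pos_right hvx hE.le
    have h1 := heq x
    have h2 := heq (x + s)
    have e : x + s - τ = x - τ + s := by ring
    rw [e] at h2
    have h3 : (1 + c * lam - lam ^ 2) * (φ x - φ (x + s))
        ≤ g (φ (x - τ)) - g (φ (x - τ + s)) := by
      linear_combination hd2' - c * hd1' - h1 + h2
    have h4 : 0 < p * Real.exp (-(lam * τ)) := by positivity
    have h5 : p * Real.exp (-(lam * τ)) * (φ x - φ (x + s))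
        ≤ g (φ (x - τ)) - g (φ (x - τ + s)) :=
      (mul_le_mul_of_nonneg_right hchar hux.le).trans h3
    have h6 : φ (x - τ + s) ≤ φ (x - τ) := by
      by_contra! hlt
      linarith [hgmono hlt.le, mul_pos h4 hux]
    have h7 := h5.trans (hgLip _ _ h6)
    rw [mul_assoc] at h7
    have h8 := le_of_mul_le_mul_left h7 (by linarith)
    have h9 : v x ≤ v (x - τ) := by
      have e2 : Real.exp (-(lam * (x - τ))) * Real.exp (-(lam * τ)) = Real.exp (-(lam * x)) := by
        rw [← Real.exp_add]; congr 1; ring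
      simp only [hv]
      rw [← e2, mul_assoc]
      exact mul_le_mul_of_nonneg_left h8 (Real.exp_pos _).le
    exact fun y => (hx y).trans h9
  have hiter : ∀ n : ℕ, ∀ y, v y ≤ v (z1 - n * τ) := by
    intro n
    induction n with
    | zero => simpa using hz1
    | succ n ih =>
      have := hback _ ih
      have e : z1 - n * τ - τ = z1 - (n + 1 : ℕ) * τ := by push_cast; ring
      rwa [e] at this
  obtain ⟨n, hn⟩ := exists_nat_ge ((z1 - Z) / τ)
  rw [div_le_iff₀ hτ] at hn
  linarith [hiter n z0, hvZ (z1 - n * τ) (by linarith)]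

theorem eta_nonneg (lam x : ℝ) : 0 ≤ eta lam x := le_min (Real.exp_pos _).le zero_le_one

theorem continuous_eta (lam : ℝ) : Continuous (eta lam) := by
  unfold eta
  fun_prop

theorem eta_le_eta_of_le {lam x y : ℝ} (hlam : 0 ≤ lam) (hxy : x ≤ y) : eta lam x ≤ eta lam y :=
  min_le_min_right _ (Real.exp_le_exp.2 (mul_le_mul_of_nonneg_left hxy hlam))

theorem exp_mul_eta_le {lam b : ℝ} (hlam : 0 ≤ lam) (hb : 0 ≤ b) (x : ℝ) :
    Real.exp (-(lam * b)) * eta lam x ≤ eta lam (x - b) := by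
  refine le_min ?_ ?_
  · calc Real.exp (-(lam * b)) * eta lam x
        ≤ Real.exp (-(lam * b)) * Real.exp (lam * x) :=
          mul_le_mul_of_nonneg_left (min_le_left _ _) (Real.exp_pos _).le
      _ = Real.exp (lam * (x - b)) := by rw [← Real.exp_add]; congr 1; ring
  · exact mul_le_one₀ (Real.exp_le_one_iff.2 (by nlinarith)) (eta_nonneg _ _) (min_le_right _ _)

/-- Comparison with the barrier `q e^{-γt} η_λ(z - b)` on a time slab. At each point it suffices to
check the differential inequality against an exponential barrier touching from above. -/
theorem le_barrier_of_subsolution {a a_t a_z a_zz : ℝ → ℝ → ℝ} {T0 T1 c q γ lam b M : ℝ}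
    (hq : 0 ≤ q)
    (hcont : ContinuousOn (fun p : ℝ × ℝ => a p.1 p.2) (Icc T0 T1 ×ˢ univ))
    (hM : ∀ t ∈ Icc T0 T1, ∀ z, a t z ≤ M)
    (ht : ∀ t ∈ Ioc T0 T1, ∀ z, HasDerivAt (fun τ => a τ z) (a_t t z) t)
    (hz : ∀ t ∈ Ioc T0 T1, ∀ z, HasDerivAt (a t) (a_z t z) z)
    (hzz : ∀ t ∈ Ioc T0 T1, ∀ z, HasDerivAt (a_z t) (a_zz t z) z)
    (hineq : ∀ t ∈ Ioc T0 T1, ∀ z, ∃ l, (∀ y, eta lam (y - b) ≤ Real.exp (l * (y - b))) ∧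
      eta lam (z - b) = Real.exp (l * (z - b)) ∧
      a_t t z - a_zz t z + c * a_z t z + a t z
        ≤ q * Real.exp (-(γ * t)) * Real.exp (l * (z - b)) * (-γ - l ^ 2 + c * l + 1))
    (hinit : ∀ z, a T0 z ≤ q * Real.exp (-(γ * T0)) * eta lam (z - b)) :
    ∀ t ∈ Icc T0 T1, ∀ z, a t z ≤ q * Real.exp (-(γ * t)) * eta lam (z - b) := by
  set B : ℝ → ℝ → ℝ := fun t z => q * Real.exp (-(γ * t)) * eta lam (z - b) with hB
  set ζ : ℝ → ℝ → ℝ := fun t z => 1 + z ^ 2 + (c ^ 2 + 2) * (t - T0) with hζ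
  have hB0 : ∀ t z, 0 ≤ B t z := fun t z =>
    mul_nonneg (mul_nonneg hq (Real.exp_pos _).le) (eta_nonneg _ _)
  have hζ1 : ∀ t ∈ Icc T0 T1, ∀ z, 1 + z ^ 2 ≤ ζ t z := fun t ht z => by
    have : 0 ≤ (c ^ 2 + 2) * (t - T0) := mul_nonneg (by positivity) (by linarith [ht.1])
    simp only [hζ]; linarith
  suffices H : ∀ ε > 0, ∀ t ∈ Icc T0 T1, ∀ z, a t z - B t z - ε * ζ t z ≤ 0 by
    intro t ht z
    by_contra! hlt
    have hζpos : 0 < ζ t z := by nlinarith [hζ1 t ht z]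
    have hlt' : 0 < a t z - B t z := sub_pos.2 hlt
    have := H ((a t z - B t z) / (2 * ζ t z)) (by positivity) t ht z
    have e : (a t z - B t z) / (2 * ζ t z) * ζ t z = (a t z - B t z) / 2 := by field_simp
    linarith
  intro ε hε
  by_contra! hcon
  obtain ⟨t1, ht1, z1, hpos1⟩ := hcon
  set u : ℝ → ℝ → ℝ := fun t z => a t z - B t z - ε * ζ t z with hu
  set R := |M| / ε + 1 with hR
  have hR1 : 1 ≤ R := by
    have : 0 ≤ |M| / ε := by positivity
    linarith
  have hfar : ∀ t ∈ Icc T0 T1, ∀ z, z ∉ Icc (-R) R → u t z ≤ 0 := by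
    intro t ht z hzR
    have hzR' : R < |z| := by
      by_contra! h
      exact hzR (abs_le.1 h)
    have h1 : R ≤ z ^ 2 := by rw [← sq_abs]; nlinarith
    have h2 : |M| ≤ ε * z ^ 2 := by
      have : |M| = ε * (|M| / ε) := by field_simp
      rw [this]
      exact mul_le_mul_of_nonneg_left (by linarith) hε.le
    have h3 := mul_le_mul_of_nonneg_left (hζ1 t ht z) hε.le
    simp only [hu]
    linarith [hM t ht z, le_abs_self M, hB0 t z]
  have hucont : ContinuousOn (fun p : ℝ × ℝ => u p.1 p.2) (Icc T0 T1 ×ˢ univ) := by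
    refine (hcont.sub ?_).sub ?_
    · have := (continuous_eta lam)
      exact Continuous.continuousOn (by simp only [hB]; fun_prop)
    · exact Continuous.continuousOn (by simp only [hζ]; fun_prop)
  have hmem1 : (t1, z1) ∈ Icc T0 T1 ×ˢ Icc (-R) R := by
    refine ⟨ht1, ?_⟩
    by_contra h
    exact absurd (hfar t1 ht1 z1 h) (not_le.2 hpos1)
  obtain ⟨⟨ts, zs⟩, hmem, hmax⟩ := (isCompact_Icc.prod isCompact_Icc).exists_isMaxOn
    ⟨_, hmem1⟩ (hucont.mono (prod_mono_right (subset_univ _)))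
  have hts : ts ∈ Icc T0 T1 := hmem.1
  have husp : 0 < u ts zs := hpos1.trans_le (hmax hmem1)
  have hglob : ∀ t ∈ Icc T0 T1, ∀ z, u t z ≤ u ts zs := by
    intro t ht z
    by_cases h : z ∈ Icc (-R) R
    · exact hmax (show (t, z) ∈ Icc T0 T1 ×ˢ Icc (-R) R from ⟨ht, h⟩)
    · exact (hfar t ht z h).trans husp.le
  have hts0 : T0 < ts := by
    refine lt_of_le_of_ne hts.1 fun h => ?_
    subst h
    have h1 := mul_le_mul_of_nonneg_left (hζ1 T0 hts zs) hε.le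
    have h2 := hinit zs
    simp only [hu, hB] at husp
    nlinarith [sq_nonneg zs]
  have htsIoc : ts ∈ Ioc T0 T1 := ⟨hts0, hts.2⟩
  obtain ⟨l, hl1, hl2, hl3⟩ := hineq ts htsIoc zs
  set f : ℝ → ℝ → ℝ := fun t z =>
    a t z - q * Real.exp (-(γ * t)) * Real.exp (l * (z - b)) - ε * ζ t z with hf
  have hfu : ∀ t z, f t z ≤ u t z := by
    intro t z
    have := mul_le_mul_of_nonneg_left (hl1 z) (mul_nonneg hq (Real.exp_pos (-(γ * t))).le)
    simp only [hf, hu, hB]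
    linarith
  have hfs : f ts zs = u ts zs := by simp only [hf, hu, hB, hl2]
  have hfmax : ∀ t ∈ Icc T0 T1, ∀ z, f t z ≤ f ts zs := fun t ht z =>
    (hfu t z).trans ((hglob t ht z).trans hfs.ge)
  set E := q * Real.exp (-(γ * ts)) * Real.exp (l * (zs - b)) with hE
  have hexpz : ∀ z, HasDerivAt (fun z => Real.exp (l * (z - b)))
      (Real.exp (l * (z - b)) * l) z := fun z => by
    simpa using (((hasDerivAt_id z).sub_const b).const_mul l).exp
  have hexpt : HasDerivAt (fun t => Real.exp (-(γ * t))) (Real.exp (-(γ * ts)) * (-γ)) ts := by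
    simpa using ((hasDerivAt_id ts).const_mul γ).neg.exp
  have hft : 0 ≤ a_t ts zs + γ * E - ε * (c ^ 2 + 2) := by
    have hζt : HasDerivAt (fun t => ζ t zs) (c ^ 2 + 2) ts := by
      exact ((((hasDerivAt_id ts).sub_const T0).const_mul (c ^ 2 + 2)).const_add
        (1 + zs ^ 2)).congr_deriv (by ring)
    have hd : HasDerivAt (fun t => f t zs) (a_t ts zs + γ * E - ε * (c ^ 2 + 2)) ts := by
      refine (((ht ts htsIoc zs).sub ((hexpt.const_mul q).mul_const _)).sub
        (hζt.const_mul ε)).congr_deriv ?_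
      rw [hE]; ring
    exact deriv_nonneg_of_forall_le_left hd hts0
      fun y hy => hfmax y ⟨hy.1.le, hy.2.trans hts.2⟩ zs
  have hζz : ∀ z, HasDerivAt (fun z => ζ ts z) (2 * z) z := fun z => by
    exact (((hasDerivAt_pow 2 z).const_add 1).add_const
      ((c ^ 2 + 2) * (ts - T0))).congr_deriv (by simp)
  have hfz : ∀ z, HasDerivAt (f ts) (a_z ts z
      - q * Real.exp (-(γ * ts)) * (Real.exp (l * (z - b)) * l) - ε * (2 * z)) z := fun z =>
    ((hz ts htsIoc z).sub ((hexpz z).const_mul _)).sub ((hζz z).const_mul ε)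
  have hfzz := ((hzz ts htsIoc zs).sub (((hexpz zs).mul_const l).const_mul
    (q * Real.exp (-(γ * ts))))).sub (((hasDerivAt_id zs).const_mul 2).const_mul ε)
  have hz0 := (show IsLocalMax (f ts) zs from
    Eventually.of_forall (hfmax ts hts)).hasDerivAt_eq_zero (hfz zs)
  have hzz0 := second_deriv_nonpos_of_forall_le hfz hfzz (hfmax ts hts)
  have hfpos : 0 < a ts zs - E - ε * ζ ts zs := by rw [← hfs] at husp; exact husp
  have h1 := mul_le_mul_of_nonneg_left (hζ1 ts hts zs) hε.le
  have e1 : a_z ts zs = E * l + ε * (2 * zs) := by rw [hE]; linear_combination hz0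
  have e2 : a_zz ts zs ≤ E * l ^ 2 + 2 * ε := by rw [hE]; linear_combination hzz0
  rw [e1] at hl3
  have h2 := mul_nonneg hε.le (sq_nonneg (zs + c))
  nlinarith

/-- **Corollary (local stability of fronts, Corollary `simp`).**
Under the hypotheses of the squeezing lemma, if
`sup_{s∈[−h,0]} |φ(·) − w₀(s,·)|_λ < ρ e^{−λb}` for some `ρ ≤ min{q*, q_*}`, then
`|φ(·) − w(t,·)|_λ < ρ e^{−γt}` for all `t ≥ 0`.  (The weighted sup-norm strict bound
`|f|_λ < β` is rendered as: `∃ q < β` with `|f| ≤ q·η_λ` pointwise.) -/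
theorem local_stability_of_fronts
    (g : ℝ → ℝ) (kap del0 Lg h c : ℝ)
    (hH : HypH g kap del0 Lg) (hmono : StrictMono g) (hLg : Lg = deriv g 0)
    (hh : 0 < h) (hc : 0 < c)
    (φ : ℝ → ℝ) (hφ : IsWavefront g h c kap φ)
    (qstar qlow dstar gstar : ℝ)
    (hqstar : 0 < qstar) (hqlow : qlow ∈ Set.Ioo 0 kap)
    (hdstar : dstar ∈ Set.Ioo (0:ℝ) del0) (hgstar : 0 < gstar)
    (hGG1 : GG1 g kap h dstar qlow gstar)
    (hGG2 : GG2 g kap h dstar qstar gstar)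
    (γ lam : ℝ) (hγ : γ ∈ Set.Ico 0 gstar) (hlam : 0 < lam)
    (hkey : 0 ≤ -γ + c * lam - lam ^ 2 + 1
        - deriv g 0 * Real.exp (γ * h) * Real.exp (-(lam * c * h)))
    (b : ℝ) (hb : 0 < b) (hbφ : φ (b - c * h) = kap - dstar / 2)
    (ρ : ℝ) (hρ : 0 < ρ) (hρle : ρ ≤ min qstar qlow)
    -- sup_{s∈[−h,0]} |φ(·) − w₀(s,·)|_λ < ρ e^{−λb}
    (w0 : ℝ → ℝ → ℝ)
    (hpert : ∃ q < ρ * Real.exp (-(lam * b)), ∀ s ∈ Set.Icc (-h) 0, ∀ z : ℝ,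
        |φ z - w0 s z| ≤ q * eta lam z)
    -- w : a classical solution of (E1) with initial datum w₀
    (w : ℝ → ℝ → ℝ) (hw : SolvesE1 g h c w)
    (hinit : ∀ s ∈ Set.Icc (-h) 0, ∀ z : ℝ, w s z = w0 s z) :
    ∀ t ≥ (0:ℝ), ∃ q < ρ * Real.exp (-(γ * t)), ∀ z : ℝ,
      |φ z - w t z| ≤ q * eta lam z := by
  obtain ⟨hφpos, -, hφC2, hφeq, hφbot, hφtop⟩ := hφ
  obtain ⟨hwcont, hwbdd, hwsol, -, -, -⟩ := hw
  obtain ⟨hγ0, hγlt⟩ := hγ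
  have hp : 1 < deriv g 0 := hH.deriv0_gt
  have hg0 : g 0 = 0 := (hH.fixed_points 0 le_rfl).2 (Or.inl rfl)
  have hgd : HasDerivAt g (deriv g 0) 0 :=
    (differentiableAt_of_deriv_ne_zero (by linarith)).hasDerivAt
  have hgLip : ∀ u v, u ≤ v → g v - g u ≤ deriv g 0 * (v - u) := by
    have hnn : ∀ u v, 0 ≤ u → u ≤ v → g v - g u ≤ deriv g 0 * (v - u) := by
      intro u v hu huv
      have := hH.lipschitz v u (hu.trans huv) hu
      rw [hLg, abs_of_nonneg (sub_nonneg.2 huv)] at this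
      exact (le_abs_self _).trans this
    intro u v huv
    rcases le_total 0 u with hu | hu
    · exact hnn u v hu huv
    · have hgu := hH.ext_linear u hu
      rcases le_total 0 v with hv | hv
      · have := hnn 0 v le_rfl hv
        rw [hg0] at this
        linarith
      · linarith [hH.ext_linear v hv]
  have hφd : ∀ z, HasDerivAt φ (deriv φ z) z := fun z =>
    (hφC2.differentiable (by norm_num) z).hasDerivAt
  have hφd' : ∀ z, HasDerivAt (deriv φ) (deriv (deriv φ) z) z := by
    have h2 : ContDiff ℝ (1 + 1) φ := by simpa [one_add_one_eq_two] using hφC2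
    exact fun z => ((contDiff_succ_iff_deriv.1 h2).2.2.differentiable (by norm_num) z).hasDerivAt
  have hφmono : Monotone φ := by
    refine monotone_profile hc (mul_pos hc hh) hp hlam hg0 hgd hmono.monotone hgLip ?_ hφd hφd'
      hφpos hφeq hφbot hφtop
    have h1 : 1 ≤ Real.exp (γ * h) := Real.one_le_exp (mul_nonneg hγ0 hh.le)
    have h2 : 0 < deriv g 0 * Real.exp (-(lam * c * h)) := by positivity
    rw [← mul_assoc lam c h]
    nlinarith
  have hφle : ∀ z, φ z ≤ kap := fun z => hφmono.ge_of_tendsto hφtop z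
  obtain ⟨q0, hq0, hq0w⟩ := hpert
  have hq0nn : 0 ≤ q0 := by
    have h1 := (abs_nonneg _).trans (hq0w 0 ⟨by linarith, le_rfl⟩ 0)
    simpa [eta] using h1
  set q := q0 * Real.exp (lam * b) with hq
  have hexpb : Real.exp (lam * b) * Real.exp (-(lam * b)) = 1 := by rw [← Real.exp_add]; simp
  have hqnn : 0 ≤ q := by positivity
  have hqρ : q < ρ := by
    have := mul_lt_mul_of_pos_right hq0 (Real.exp_pos (lam * b))
    calc q < ρ * Real.exp (-(lam * b)) * Real.exp (lam * b) := this
      _ = ρ := by rw [mul_assoc, mul_comm (Real.exp _), hexpb, mul_one]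
  have hstart : ∀ t ∈ Icc (-h) 0, ∀ z,
      |w t z - φ z| ≤ q * Real.exp (-(γ * t)) * eta lam (z - b) := by
    intro t ht z
    rw [hinit t ht z, abs_sub_comm]
    have h1 : 1 ≤ Real.exp (-(γ * t)) := Real.one_le_exp (by nlinarith [ht.2])
    have h2 := exp_mul_eta_le hlam.le hb.le z
    calc |φ z - w0 t z| ≤ q0 * eta lam z := hq0w t ht z
      _ = q * (Real.exp (-(lam * b)) * eta lam z) := by
          rw [hq]; linear_combination -(q0 * eta lam z) * hexpb
      _ ≤ q * eta lam (z - b) := mul_le_mul_of_nonneg_left h2 hqnn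
      _ ≤ q * Real.exp (-(γ * t)) * eta lam (z - b) :=
          mul_le_mul_of_nonneg_right (le_mul_of_one_le_right hqnn h1) (eta_nonneg _ _)
  -- the reaction difference is dominated by the barrier
  have hreact : ∀ t ≥ (0 : ℝ), ∀ z,
      |w (t - h) (z - c * h) - φ (z - c * h)|
        ≤ q * Real.exp (-(γ * (t - h))) * eta lam (z - c * h - b) →
      ∃ l, (∀ y, eta lam (y - b) ≤ Real.exp (l * (y - b))) ∧
        eta lam (z - b) = Real.exp (l * (z - b)) ∧
        |g (w (t - h) (z - c * h)) - g (φ (z - c * h))|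
          ≤ q * Real.exp (-(γ * t)) * Real.exp (l * (z - b)) * (-γ - l ^ 2 + c * l + 1) := by
    intro t ht z hd
    have eγ : Real.exp (-(γ * (t - h))) = Real.exp (-(γ * t)) * Real.exp (γ * h) := by
      rw [← Real.exp_add]; congr 1; ring
    rw [eγ] at hd
    set x := w (t - h) (z - c * h)
    set y := φ (z - c * h)
    set Q := q * Real.exp (-(γ * t)) with hQ
    have hQ0 : 0 ≤ Q := by positivity
    rcases le_total z b with hzb | hzb
    · refine ⟨lam, fun y => min_le_left _ _,
        min_eq_left (Real.exp_le_one_iff.2 (by nlinarith)), ?_⟩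
      have h1 : |g x - g y| ≤ deriv g 0 * |x - y| := by
        rcases le_total x y with hxy | hxy
        · rw [abs_sub_comm, abs_sub_comm x, abs_of_nonneg (sub_nonneg.2 (hmono.monotone hxy)),
            abs_of_nonneg (sub_nonneg.2 hxy)]
          exact hgLip x y hxy
        · rw [abs_of_nonneg (sub_nonneg.2 (hmono.monotone hxy)),
            abs_of_nonneg (sub_nonneg.2 hxy)]
          exact hgLip y x hxy
      have e2 : Real.exp (lam * (z - c * h - b))
          = Real.exp (lam * (z - b)) * Real.exp (-(lam * c * h)) := by
        rw [← Real.exp_add]; congr 1; ring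
      have h2 : |x - y| ≤ Q * Real.exp (γ * h) *
          (Real.exp (lam * (z - b)) * Real.exp (-(lam * c * h))) := by
        rw [← e2, hQ, mul_assoc q]
        exact hd.trans (mul_le_mul_of_nonneg_left (min_le_left _ _) (by positivity))
      have h3 := h1.trans (mul_le_mul_of_nonneg_left h2 (by linarith))
      have h4 := mul_nonneg (mul_nonneg hQ0 (Real.exp_pos (lam * (z - b))).le) hkey
      linarith
    · refine ⟨0, fun y => by rw [zero_mul, Real.exp_zero]; exact min_le_right _ _, ?_, ?_⟩
      · rw [zero_mul, Real.exp_zero]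
        exact min_eq_right (Real.one_le_exp (mul_nonneg hlam.le (by linarith)))
      have hyκ : y ∈ Icc (kap - dstar) kap := by
        refine ⟨?_, hφle _⟩
        have : φ (b - c * h) ≤ y := hφmono (by linarith)
        linarith [hdstar.1]
      have hQq : Q ≤ ρ := by
        have h1 : Real.exp (-(γ * t)) ≤ 1 :=
          Real.exp_le_one_iff.2 (neg_nonpos.2 (mul_nonneg hγ0 ht))
        exact (mul_le_of_le_one_right hqnn h1).trans hqρ.le
      have hlow := hGG1 y hyκ Q ⟨hQ0, hQq.trans (hρle.trans (min_le_right _ _))⟩ γ ⟨hγ0, hγlt.le⟩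
      have hupp := hGG2 y hyκ Q ⟨hQ0, hQq.trans (hρle.trans (min_le_left _ _))⟩ γ ⟨hγ0, hγlt.le⟩
      have hxy : |x - y| ≤ Q * Real.exp (γ * h) := by
        rw [← mul_assoc q] at hd
        exact hd.trans (mul_le_of_le_one_right (by positivity) (min_le_right _ _))
      obtain ⟨hx1, hx2⟩ := abs_le.1 hxy
      have h1 : g (y - Q * Real.exp (γ * h)) ≤ g x := hmono.monotone (by linarith)
      have h2 : g x ≤ g (y + Q * Real.exp (γ * h)) := hmono.monotone (by linarith)
      have h3 := mul_nonneg hQ0 hγ0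
      rw [zero_mul, Real.exp_zero, mul_one]
      exact abs_le.2 ⟨by linarith, by linarith⟩
  have hind : ∀ n : ℕ, ∀ t ∈ Icc (-h) (n * h), ∀ z,
      |w t z - φ z| ≤ q * Real.exp (-(γ * t)) * eta lam (z - b) := by
    intro n
    induction n with
    | zero => simpa using hstart
    | succ n ih =>
      intro t ht z
      rcases le_total t (n * h) with htn | htn
      · exact ih t ⟨ht.1, htn⟩ z
      have hnh : 0 ≤ (n : ℝ) * h := by positivity
      set T0 := (n : ℝ) * h
      have e1 : ((n + 1 : ℕ) : ℝ) * h = T0 + h := by push_cast; ring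
      rw [e1] at ht
      have hslab : ∀ σ : ℝ, |σ| = 1 → σ * (w t z - φ z)
          ≤ q * Real.exp (-(γ * t)) * eta lam (z - b) := by
        intro σ hσ
        obtain ⟨M, hM⟩ := hwbdd (T0 + h)
        refine le_barrier_of_subsolution (a := fun t z => σ * (w t z - φ z))
          (a_t := fun t z => σ * deriv (fun τ => w τ z) t)
          (a_z := fun t z => σ * (deriv (fun y => w t y) z - deriv φ z))
          (a_zz := fun t z => σ * (deriv (deriv (fun y => w t y)) z - deriv (deriv φ) z))
          (T0 := T0) (T1 := T0 + h) (c := c) (M := M + kap) hqnn ?_ ?_ ?_ ?_ ?_ ?_ ?_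
          t ⟨htn, ht.2⟩ z
        · refine continuousOn_const.mul ((hwcont.mono ?_).sub ?_)
          · rintro ⟨s, y⟩ ⟨hs, -⟩
            exact show -h ≤ s by linarith [hs.1]
          · exact (hφC2.continuous.comp continuous_snd).continuousOn
        · intro s hs y
          have h1 := hM s ⟨by linarith [hs.1], hs.2⟩ y
          have h2 : |φ y| ≤ kap := by rw [abs_of_pos (hφpos y)]; exact hφle y
          calc σ * (w s y - φ y) ≤ |σ * (w s y - φ y)| := le_abs_self _
            _ = |w s y - φ y| := by rw [abs_mul, hσ, one_mul]
            _ ≤ |w s y| + |φ y| := abs_sub _ _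
            _ ≤ M + kap := add_le_add h1 h2
        · intro s hs y
          exact (((hwsol s (hnh.trans_lt hs.1) y).1.hasDerivAt).sub_const (φ y)).const_mul σ
        · intro s hs y
          exact (((hwsol s (hnh.trans_lt hs.1) y).2.1.hasDerivAt).sub (hφd y)).const_mul σ
        · intro s hs y
          exact (((hwsol s (hnh.trans_lt hs.1) y).2.2.1.hasDerivAt).sub (hφd' y)).const_mul σ
        · intro s hs y
          obtain ⟨l, hl1, hl2, hl3⟩ := hreact s (hnh.trans hs.1.le) y
            (ih (s - h) ⟨by linarith [hs.1], by linarith [hs.2]⟩ (y - c * h))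
          have h5 : σ * (g (w (s - h) (y - c * h)) - g (φ (y - c * h))) ≤
              |g (w (s - h) (y - c * h)) - g (φ (y - c * h))| :=
            (le_abs_self _).trans_eq (by rw [abs_mul, hσ, one_mul])
          refine ⟨l, hl1, hl2, le_trans (le_of_eq ?_) (h5.trans hl3)⟩
          linear_combination σ * (hwsol s (hnh.trans_lt hs.1) y).2.2.2 + σ * hφeq y
        · intro y
          refine ((le_abs_self _).trans_eq ?_).trans (ih T0 ⟨by linarith, le_rfl⟩ y)
          rw [abs_mul, hσ, one_mul]
      have h1 := hslab 1 (by simp)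
      have h2 := hslab (-1) (by simp)
      exact abs_le.2 ⟨by linarith, by linarith⟩
  intro t ht
  refine ⟨q * Real.exp (-(γ * t)), mul_lt_mul_of_pos_right hqρ (Real.exp_pos _), fun z => ?_⟩
  obtain ⟨n, hn⟩ := exists_nat_ge (t / h)
  rw [div_le_iff₀ hh] at hn
  rw [abs_sub_comm]
  exact (hind n t ⟨by linarith, hn⟩ z).trans (mul_le_mul_of_nonneg_left
    (eta_le_eta_of_le hlam.le (by linarith)) (by positivity))
end
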